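/- (Nonexistence form of Theorem 2.1) Let H be a real inner product space, t₀ ∈ ℝ, c > 0, ϖ₀ > 0, v₀ > 0, and set T₀ = t₀ + 1/(c ϖ₀ v₀). Then there is no twice continuously differentiable curve W : [t₀, T₀] → H such that W(t) ≠ 0 for all t, ⟨W(t), W''(t)⟩ ≥ (3 + c) · ‖W'(t)‖² for all t ∈ [t₀, T₀], ‖W(t₀)‖² = ϖ₀, and ⟨W(t₀), W'(t₀)⟩ / ϖ₀² = v₀. In particular, any such curve defined on a half-open interval [t₀, T) must have T ≤ T₀, and ‖W'(t)‖ becomes unbounded as t approaches T₀ from below whenever T = T₀. -/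

import Mathlib

open scoped RealInnerProductSpace

/-- If `⟪W, W''⟫ ≥ (3 + c) ‖W'‖²` on `[a, b]` and `⟪W a, W' a⟫ > 0`, then the length of `[a, b]`
is less than `‖W a‖² / ((2 + c) ⟪W a, W' a⟫)`. -/
lemma length_mul_inner_lt_norm_sq {H : Type*} [NormedAddCommGroup H] [InnerProductSpace ℝ H]
    {a b c : ℝ} (hab : a ≤ b) (hc : 0 < c) {W W' W'' : ℝ → H}
    (hW : ∀ t ∈ Set.Icc a b, HasDerivWithinAt W (W' t) (Set.Icc a b) t)
    (hW' : ∀ t ∈ Set.Icc a b, HasDerivWithinAt W' (W'' t) (Set.Icc a b) t)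
    (hconv : ∀ t ∈ Set.Icc a b, (3 + c) * ‖W' t‖ ^ 2 ≤ ⟪W t, W'' t⟫)
    (hpos : 0 < ⟪W a, W' a⟫) :
    (2 + c) * (b - a) * ⟪W a, W' a⟫ < ‖W a‖ ^ 2 := by
  have hp : ∀ t ∈ Set.Icc a b, HasDerivWithinAt (fun s => ⟪W s, W' s⟫)
      (⟪W t, W'' t⟫ + ⟪W' t, W' t⟫) (Set.Icc a b) t :=
    fun t ht => (hW t ht).inner ℝ (hW' t ht)
  have hq : ∀ t ∈ Set.Icc a b, HasDerivWithinAt (fun s => ‖W s‖ ^ 2)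
      (2 * ⟪W t, W' t⟫) (Set.Icc a b) t := fun t ht => (hW t ht).norm_sq
  have hmono : MonotoneOn (fun s => ⟪W s, W' s⟫) (Set.Icc a b) := by
    refine monotoneOn_of_hasDerivWithinAt_nonneg (convex_Icc a b)
      (fun t ht => (hp t ht).continuousWithinAt)
      (fun t ht => (hp t (interior_subset ht)).mono interior_subset) fun t ht => ?_
    have h := hconv t (interior_subset ht)
    rw [real_inner_self_eq_norm_sq]
    have : 0 ≤ (3 + c) * ‖W' t‖ ^ 2 := by positivity
    linarith [sq_nonneg ‖W' t‖]
  have hppos : ∀ t ∈ Set.Icc a b, 0 < ⟪W t, W' t⟫ := fun t ht =>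
    hpos.trans_le (hmono (Set.left_mem_Icc.2 hab) ht ht.1)
  have hg : ∀ t ∈ Set.Icc a b, HasDerivWithinAt
      (fun s => ‖W s‖ ^ 2 / ⟪W s, W' s⟫ + (2 + c) * s)
      ((2 * ⟪W t, W' t⟫ * ⟪W t, W' t⟫ - ‖W t‖ ^ 2 * (⟪W t, W'' t⟫ + ⟪W' t, W' t⟫)) /
        ⟪W t, W' t⟫ ^ 2 + (2 + c) * 1) (Set.Icc a b) t := fun t ht =>
    ((hq t ht).fun_div (hp t ht) (hppos t ht).ne').fun_add
      ((hasDerivWithinAt_id t _).const_mul (2 + c))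
  have hanti : AntitoneOn (fun s => ‖W s‖ ^ 2 / ⟪W s, W' s⟫ + (2 + c) * s) (Set.Icc a b) := by
    refine antitoneOn_of_hasDerivWithinAt_nonpos (convex_Icc a b)
      (fun t ht => (hg t ht).continuousWithinAt)
      (fun t ht => (hg t (interior_subset ht)).mono interior_subset) fun t ht => ?_
    have htp := hppos t (interior_subset ht)
    have hcs : ⟪W t, W' t⟫ ^ 2 ≤ ‖W t‖ ^ 2 * ‖W' t‖ ^ 2 := by
      rw [← mul_pow]
      exact pow_le_pow_left₀ htp.le (real_inner_le_norm _ _) 2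
    have h := mul_le_mul_of_nonneg_left (hconv t (interior_subset ht)) (sq_nonneg ‖W t‖)
    rw [real_inner_self_eq_norm_sq, ← le_neg_iff_add_nonpos_right, div_le_iff₀ (by positivity)]
    nlinarith [mul_le_mul_of_nonneg_left hcs (by positivity : 0 ≤ 4 + c)]
  have hle := hanti (Set.left_mem_Icc.2 hab) (Set.right_mem_Icc.2 hab) hab
  have hb := hppos b (Set.right_mem_Icc.2 hab)
  have hWb : W b ≠ 0 := by
    intro h
    simp [h] at hb
  have hquot : 0 < ‖W b‖ ^ 2 / ⟪W b, W' b⟫ := by positivity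
  rw [← lt_div_iff₀ hpos]
  simp only at hle
  linarith

/-- Nonexistence form of Theorem 2.1: no twice continuously differentiable nonvanishing
curve with `⟨W, W''⟩ ≥ (3 + c) ‖W'‖²`, `‖W(t₀)‖² = ϖ₀` and `v(t₀) = v₀ > 0` can exist on
the closed interval `[t₀, T₀]`, `T₀ = t₀ + 1/(c ϖ₀ v₀)`; moreover any such curve on a
half-open interval `[t₀, T)` has `T ≤ T₀`, and `‖W'(t)‖` is unbounded as `t ↑ T₀` when
`T = T₀`. -/
theorem stmt6 {H : Type*} [NormedAddCommGroup H] [InnerProductSpace ℝ H]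
    (t₀ c ϖ₀ v₀ : ℝ) (hc : 0 < c) (hϖ₀ : 0 < ϖ₀) (hv₀ : 0 < v₀) :
    (¬ ∃ W W' W'' : ℝ → H,
      (∀ t ∈ Set.Icc t₀ (t₀ + 1 / (c * ϖ₀ * v₀)),
        HasDerivWithinAt W (W' t) (Set.Icc t₀ (t₀ + 1 / (c * ϖ₀ * v₀))) t) ∧
      (∀ t ∈ Set.Icc t₀ (t₀ + 1 / (c * ϖ₀ * v₀)),
        HasDerivWithinAt W' (W'' t) (Set.Icc t₀ (t₀ + 1 / (c * ϖ₀ * v₀))) t) ∧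
      ContinuousOn W'' (Set.Icc t₀ (t₀ + 1 / (c * ϖ₀ * v₀))) ∧
      (∀ t ∈ Set.Icc t₀ (t₀ + 1 / (c * ϖ₀ * v₀)), W t ≠ 0) ∧
      (∀ t ∈ Set.Icc t₀ (t₀ + 1 / (c * ϖ₀ * v₀)),
        ⟪W t, W'' t⟫ ≥ (3 + c) * ‖W' t‖ ^ 2) ∧
      ‖W t₀‖ ^ 2 = ϖ₀ ∧
      ⟪W t₀, W' t₀⟫ / ϖ₀ ^ 2 = v₀) ∧
    (∀ T : EReal, (t₀ : EReal) < T → ∀ W W' W'' : ℝ → H,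
      (∀ t : ℝ, t₀ ≤ t → (t : EReal) < T →
        HasDerivWithinAt W (W' t) {s : ℝ | t₀ ≤ s ∧ (s : EReal) < T} t) →
      (∀ t : ℝ, t₀ ≤ t → (t : EReal) < T →
        HasDerivWithinAt W' (W'' t) {s : ℝ | t₀ ≤ s ∧ (s : EReal) < T} t) →
      ContinuousOn W'' {s : ℝ | t₀ ≤ s ∧ (s : EReal) < T} →
      (∀ t : ℝ, t₀ ≤ t → (t : EReal) < T → W t ≠ 0) →
      (∀ t : ℝ, t₀ ≤ t → (t : EReal) < T →
        ⟪W t, W'' t⟫ ≥ (3 + c) * ‖W' t‖ ^ 2) →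
      ‖W t₀‖ ^ 2 = ϖ₀ →
      ⟪W t₀, W' t₀⟫ / ϖ₀ ^ 2 = v₀ →
      T ≤ ((t₀ + 1 / (c * ϖ₀ * v₀) : ℝ) : EReal) ∧
      (T = ((t₀ + 1 / (c * ϖ₀ * v₀) : ℝ) : EReal) →
        ∀ M : ℝ, ∃ᶠ t in nhdsWithin (t₀ + 1 / (c * ϖ₀ * v₀))
          (Set.Iio (t₀ + 1 / (c * ϖ₀ * v₀))), M ≤ ‖W' t‖)) := by
  have hblow : ∀ b : ℝ, b = t₀ + 1 / ((1 + c) * ϖ₀ * v₀) → ∀ W W' W'' : ℝ → H,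
      (∀ t ∈ Set.Icc t₀ b, HasDerivWithinAt W (W' t) (Set.Icc t₀ b) t) →
      (∀ t ∈ Set.Icc t₀ b, HasDerivWithinAt W' (W'' t) (Set.Icc t₀ b) t) →
      (∀ t ∈ Set.Icc t₀ b, ⟪W t, W'' t⟫ ≥ (3 + c) * ‖W' t‖ ^ 2) →
      ‖W t₀‖ ^ 2 = ϖ₀ → ⟪W t₀, W' t₀⟫ / ϖ₀ ^ 2 = v₀ → False := by
    intro b hb W W' W'' hW hW' hconv hnorm hinner
    rw [div_eq_iff (by positivity)] at hinner
    have hlen : 0 < 1 / ((1 + c) * ϖ₀ * v₀) := by positivity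
    have h := length_mul_inner_lt_norm_sq (by linarith) hc hW hW' hconv
      (by rw [hinner]; positivity)
    rw [hinner, hnorm, hb, add_sub_cancel_left] at h
    have heq : (2 + c) * (1 / ((1 + c) * ϖ₀ * v₀)) * (v₀ * ϖ₀ ^ 2) = (2 + c) * ϖ₀ / (1 + c) := by
      field_simp
    rw [heq, div_lt_iff₀ (by positivity)] at h
    linarith
  have hlt : t₀ + 1 / ((1 + c) * ϖ₀ * v₀) < t₀ + 1 / (c * ϖ₀ * v₀) := by
    gcongr
    linarith
  constructor
  · rintro ⟨W, W', W'', hW, hW', -, -, hconv, hnorm, hinner⟩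
    have hsub : Set.Icc t₀ _ ⊆ Set.Icc t₀ _ := Set.Icc_subset_Icc_right hlt.le
    exact hblow _ rfl W W' W'' (fun t ht => (hW t (hsub ht)).mono hsub)
      (fun t ht => (hW' t (hsub ht)).mono hsub) (fun t ht => hconv t (hsub ht)) hnorm hinner
  · intro T _ W W' W'' hW hW' _ _ hconv hnorm hinner
    have hT : T < ((t₀ + 1 / (c * ϖ₀ * v₀) : ℝ) : EReal) := by
      by_contra! hT
      have hsub : Set.Icc t₀ (t₀ + 1 / ((1 + c) * ϖ₀ * v₀)) ⊆
          {s : ℝ | t₀ ≤ s ∧ (s : EReal) < T} := fun s hs =>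
        ⟨hs.1, (EReal.coe_lt_coe_iff.2 (hs.2.trans_lt hlt)).trans_le hT⟩
      exact hblow _ rfl W W' W''
        (fun t ht => (hW t (hsub ht).1 (hsub ht).2).mono hsub)
        (fun t ht => (hW' t (hsub ht).1 (hsub ht).2).mono hsub)
        (fun t ht => hconv t (hsub ht).1 (hsub ht).2) hnorm hinner
    exact ⟨hT.le, fun h => absurd h hT.ne⟩
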